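/- Under the hypotheses of the previous two statements (Lemma 3.2 of the paper): there exist constants $C>0$ and $s_2>0$ such that $\int_\Omega(|g|^2+|\nabla g|^2)e^{2s\varphi_0}\,dx \le C\int_\Omega|\nabla(e^{s\varphi_0}\mathcal{L}_0 g)|^2\,dx$ for all $s\ge s_2$ and all $g\in H_0^2(\Omega)$. -/

import Mathlib

open MeasureTheory Real

/-- The `i`-th partial derivative of `f` at `x`. -/
noncomputable def pd {n : ℕ} (f : EuclideanSpace ℝ (Fin n) → ℝ) (i : Fin n)
    (x : EuclideanSpace ℝ (Fin n)) : ℝ :=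
  fderiv ℝ f x (EuclideanSpace.single i 1)

/-- The first-order transport operator `L₀ g = div(g a ∇u₀)`. -/
noncomputable def L0op {n : ℕ}
    (a : EuclideanSpace ℝ (Fin n) → Fin n → Fin n → ℝ)
    (u0 g : EuclideanSpace ℝ (Fin n) → ℝ) (x : EuclideanSpace ℝ (Fin n)) : ℝ :=
  ∑ i, pd (fun y => g y * ∑ j, a y i j * pd u0 j y) i x

theorem pd_mul {n : ℕ} {f g : EuclideanSpace ℝ (Fin n) → ℝ} (hf : Differentiable ℝ f)
    (hg : Differentiable ℝ g) (i : Fin n) (x : EuclideanSpace ℝ (Fin n)) :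
    pd (fun y => f y * g y) i x = pd f i x * g x + f x * pd g i x := by
  simp only [pd]
  rw [fderiv_fun_mul (hf x) (hg x)]
  simp
  ring

theorem pd_sum {n : ℕ} {ι : Type*} (t : Finset ι) {f : ι → EuclideanSpace ℝ (Fin n) → ℝ}
    (hf : ∀ j, Differentiable ℝ (f j)) (i : Fin n) (x : EuclideanSpace ℝ (Fin n)) :
    pd (fun y => ∑ j ∈ t, f j y) i x = ∑ j ∈ t, pd (f j) i x := by
  simp only [pd]
  rw [fderiv_fun_sum fun j _ => hf j x]
  simp

theorem pd_add {n : ℕ} {f g : EuclideanSpace ℝ (Fin n) → ℝ} (hf : Differentiable ℝ f)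
    (hg : Differentiable ℝ g) (i : Fin n) (x : EuclideanSpace ℝ (Fin n)) :
    pd (fun y => f y + g y) i x = pd f i x + pd g i x := by
  simp only [pd]
  rw [fderiv_fun_add (hf x) (hg x)]
  simp

theorem pd_exp_const_mul {n : ℕ} {f : EuclideanSpace ℝ (Fin n) → ℝ} (hf : Differentiable ℝ f)
    (c : ℝ) (i : Fin n) (x : EuclideanSpace ℝ (Fin n)) :
    pd (fun y => Real.exp (c * f y)) i x = Real.exp (c * f x) * (c * pd f i x) := by
  simp only [pd]
  rw [fderiv_exp ((hf x).const_mul c), fderiv_const_mul (hf x)]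
  simp

theorem pd_coord {n : ℕ} (i : Fin n) (x : EuclideanSpace ℝ (Fin n)) :
    pd (fun y => y i) i x = 1 := by
  have : (fun y : EuclideanSpace ℝ (Fin n) => y i) = EuclideanSpace.proj (𝕜 := ℝ) i := rfl
  simp only [pd]
  rw [this, ContinuousLinearMap.fderiv]
  simp

theorem contDiff_pd {n : ℕ} {f : EuclideanSpace ℝ (Fin n) → ℝ} {k m : WithTop ℕ∞}
    (hf : ContDiff ℝ k f) (hm : m + 1 ≤ k) (i : Fin n) : ContDiff ℝ m (pd f i) :=
  (hf.fderiv_right hm).clm_apply contDiff_const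

theorem continuous_pd {n : ℕ} {f : EuclideanSpace ℝ (Fin n) → ℝ}
    (hf : ContDiff ℝ 1 f) (i : Fin n) : Continuous (pd f i) :=
  (contDiff_pd (m := 0) hf (by norm_num) i).continuous

theorem pd_comm {n : ℕ} {f : EuclideanSpace ℝ (Fin n) → ℝ} (hf : ContDiff ℝ 2 f)
    (i j : Fin n) (x : EuclideanSpace ℝ (Fin n)) : pd (pd f i) j x = pd (pd f j) i x := by
  have hd : DifferentiableAt ℝ (fderiv ℝ f) x :=
    ((hf.fderiv_right (m := 1) (by norm_num)).differentiable (by norm_num)) x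
  have key : ∀ i j : Fin n, pd (pd f i) j x =
      fderiv ℝ (fderiv ℝ f) x (EuclideanSpace.single j 1) (EuclideanSpace.single i 1) := by
    intro i j
    change fderiv ℝ (fun y => fderiv ℝ f y (EuclideanSpace.single i 1)) x _ = _
    rw [fderiv_clm_apply hd (differentiableAt_const _)]
    simp
  rw [key, key]
  exact (hf.contDiffAt.isSymmSndFDerivAt (by simp)) _ _

theorem pd_eq_zero_of_notMem {n : ℕ} {f : EuclideanSpace ℝ (Fin n) → ℝ}
    {K : Set (EuclideanSpace ℝ (Fin n))} (hK : IsClosed K) (hf : ∀ x ∉ K, f x = 0)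
    (i : Fin n) : ∀ x ∉ K, pd f i x = 0 := by
  intro x hx
  have : f =ᶠ[nhds x] fun _ => 0 := by
    filter_upwards [hK.isOpen_compl.mem_nhds hx] with y hy using hf y hy
  simp [pd, this.fderiv_eq]

theorem integrable_of_eq_zero_off_compact {n : ℕ} {f : EuclideanSpace ℝ (Fin n) → ℝ}
    {K : Set (EuclideanSpace ℝ (Fin n))} (hK : IsCompact K) (hc : Continuous f)
    (hf : ∀ x ∉ K, f x = 0) : Integrable f :=
  hc.integrable_of_hasCompactSupport (HasCompactSupport.intro hK hf)

theorem integral_pd_eq_zero {n : ℕ} {f : EuclideanSpace ℝ (Fin n) → ℝ}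
    {K : Set (EuclideanSpace ℝ (Fin n))} (hK : IsCompact K) (hf : ContDiff ℝ 1 f)
    (h0 : ∀ x ∉ K, f x = 0) (i : Fin n) : ∫ x, pd f i x = 0 := by
  have hi := integrable_of_eq_zero_off_compact hK hf.continuous h0
  have hi' := integrable_of_eq_zero_off_compact hK (continuous_pd hf i)
    (pd_eq_zero_of_notMem hK.isClosed h0 i)
  have := integral_mul_fderiv_eq_neg_fderiv_mul_of_integrable (𝕜 := ℝ) (μ := volume)
    (f := fun _ : EuclideanSpace ℝ (Fin n) => (1 : ℝ)) (g := f)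
    (v := EuclideanSpace.single i 1) (by simp)
    (by simpa [pd, Function.comp_def] using! hi') (by simpa using hi)
    (fun x _ => differentiableAt_const _) (fun x _ => hf.differentiable (by norm_num) x)
  simpa [pd] using this

theorem exists_bound_of_continuous {n : ℕ} {Ω : Set (EuclideanSpace ℝ (Fin n))}
    (hΩ : Bornology.IsBounded Ω) {q : EuclideanSpace ℝ (Fin n) → ℝ} (hq : Continuous q) :
    ∃ M > (0 : ℝ), ∀ x ∈ Ω, |q x| ≤ M := by
  obtain ⟨M, hM⟩ := hΩ.isCompact_closure.exists_bound_of_continuousOn hq.continuousOn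
  exact ⟨max M 1, by positivity, fun x hx => (hM x (subset_closure hx)).trans (le_max_left _ _)⟩

/-- Poincaré's inequality for continuously differentiable functions vanishing off a compact
subset of a bounded set. -/
theorem poincare_of_bounded {n : ℕ} {Ω : Set (EuclideanSpace ℝ (Fin n))}
    (hΩ : Bornology.IsBounded Ω) (i : Fin n) :
    ∃ P > (0 : ℝ), ∀ (K : Set (EuclideanSpace ℝ (Fin n))) (h : EuclideanSpace ℝ (Fin n) → ℝ),
      IsCompact K → K ⊆ Ω → ContDiff ℝ 1 h → (∀ x ∉ K, h x = 0) →
      ∫ x, h x ^ 2 ≤ P * ∫ x, pd h i x ^ 2 := by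
  have hco : ContDiff ℝ 1 fun y : EuclideanSpace ℝ (Fin n) => y i :=
    (EuclideanSpace.proj (𝕜 := ℝ) i).contDiff
  obtain ⟨R, hR, hb⟩ := exists_bound_of_continuous hΩ hco.continuous
  refine ⟨4 * R ^ 2, by positivity, fun K h hK hKΩ hh h0 => ?_⟩
  have hF : ContDiff ℝ 1 fun y => y i * (h y * h y) := hco.mul (hh.mul hh)
  have hF0 : ∀ x ∉ K, x i * (h x * h x) = 0 := fun x hx => by simp [h0 x hx]
  have hpd0 := pd_eq_zero_of_notMem hK.isClosed h0 i
  have hIF := integrable_of_eq_zero_off_compact hK (continuous_pd hF i)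
    (pd_eq_zero_of_notMem hK.isClosed hF0 i)
  have hIh := integrable_of_eq_zero_off_compact (f := fun x => h x ^ 2) hK
    (hh.continuous.pow 2) (fun x hx => by simp [h0 x hx])
  have hId := integrable_of_eq_zero_off_compact (f := fun x => pd h i x ^ 2) hK
    ((continuous_pd hh i).pow 2) (fun x hx => by simp [hpd0 x hx])
  have hle : ∫ x, h x ^ 2 ≤
      ∫ x, (2 * pd (fun y => y i * (h y * h y)) i x + 4 * R ^ 2 * pd h i x ^ 2) := by
    refine integral_mono hIh ((hIF.const_mul 2).add (hId.const_mul _)) fun x => ?_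
    have hdh := hh.differentiable (by norm_num)
    have hx2 : x i ^ 2 * pd h i x ^ 2 ≤ R ^ 2 * pd h i x ^ 2 := by
      by_cases hx : x ∈ K
      · exact mul_le_mul_of_nonneg_right (sq_le_sq' (abs_le.1 (hb x (hKΩ hx))).1
          (abs_le.1 (hb x (hKΩ hx))).2) (sq_nonneg _)
      · simp [hpd0 x hx]
    simp only
    rw [pd_mul (hco.differentiable (by norm_num)) (hdh.fun_mul hdh), pd_coord, pd_mul hdh hdh]
    nlinarith [sq_nonneg (h x + 2 * x i * pd h i x)]
  rwa [integral_add (hIF.const_mul 2) (hId.const_mul _), integral_const_mul, integral_const_mul,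
    integral_pd_eq_zero hK hF hF0, mul_zero, zero_add] at hle

/-- The operator `v ↦ div(v f)` for a vector field `f`. -/
noncomputable def divMul {n : ℕ} (f : Fin n → EuclideanSpace ℝ (Fin n) → ℝ)
    (v : EuclideanSpace ℝ (Fin n) → ℝ) (x : EuclideanSpace ℝ (Fin n)) : ℝ :=
  ∑ i, pd (fun y => v y * f i y) i x

theorem divMul_eq {n : ℕ} {f : Fin n → EuclideanSpace ℝ (Fin n) → ℝ}
    {v : EuclideanSpace ℝ (Fin n) → ℝ} (hf : ∀ i, Differentiable ℝ (f i))
    (hv : Differentiable ℝ v) (x : EuclideanSpace ℝ (Fin n)) :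
    divMul f v x = ∑ i, pd v i x * f i x + v x * ∑ i, pd (f i) i x := by
  simp only [divMul, pd_mul hv (hf _), Finset.sum_add_distrib, Finset.mul_sum]

theorem divMul_eq_zero_of_notMem {n : ℕ} (f : Fin n → EuclideanSpace ℝ (Fin n) → ℝ)
    {v : EuclideanSpace ℝ (Fin n) → ℝ} {K : Set (EuclideanSpace ℝ (Fin n))} (hK : IsClosed K)
    (h0 : ∀ x ∉ K, v x = 0) : ∀ x ∉ K, divMul f v x = 0 := fun x hx =>
  Finset.sum_eq_zero fun i _ =>
    pd_eq_zero_of_notMem (f := fun y => v y * f i y) hK (fun y hy => by simp [h0 y hy]) i x hx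

theorem contDiff_divMul {n : ℕ} {f : Fin n → EuclideanSpace ℝ (Fin n) → ℝ}
    {v : EuclideanSpace ℝ (Fin n) → ℝ} {k m : WithTop ℕ∞} (hf : ∀ i, ContDiff ℝ k (f i))
    (hv : ContDiff ℝ k v) (hm : m + 1 ≤ k) : ContDiff ℝ m (divMul f v) :=
  ContDiff.sum fun i _ => contDiff_pd (hv.mul (hf i)) hm i

/-- Weighted `L²` Carleman estimate for the transport operator `v ↦ div(v f)`. -/
theorem carleman_divMul {n : ℕ} {Ω : Set (EuclideanSpace ℝ (Fin n))}
    (hΩ : Bornology.IsBounded Ω) {f : Fin n → EuclideanSpace ℝ (Fin n) → ℝ}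
    (hf : ∀ i, ContDiff ℝ 1 (f i)) {φ : EuclideanSpace ℝ (Fin n) → ℝ} (hφ : ContDiff ℝ 2 φ)
    {b : ℝ} (hb : 0 < b) (hB : ∀ x ∈ Ω, b ≤ (∑ i, f i x * pd φ i x) ^ 2) :
    ∃ s1 > (0 : ℝ), ∀ s ≥ s1, ∀ (K : Set (EuclideanSpace ℝ (Fin n)))
      (v : EuclideanSpace ℝ (Fin n) → ℝ), IsCompact K → K ⊆ Ω → ContDiff ℝ 1 v →
      (∀ x ∉ K, v x = 0) →
      s ^ 2 * ∫ x, v x ^ 2 * Real.exp (2 * s * φ x) ≤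
        2 / b * ∫ x, divMul f v x ^ 2 * Real.exp (2 * s * φ x) := by
  set B : EuclideanSpace ℝ (Fin n) → ℝ := fun x => ∑ i, f i x * pd φ i x with hBdef
  have hφ1 : ContDiff ℝ 1 φ := hφ.of_le (by norm_num)
  have hBc : ContDiff ℝ 1 B :=
    ContDiff.sum fun i _ => (hf i).mul (contDiff_pd hφ (by norm_num) i)
  have hDc : Continuous fun x => ∑ i, pd (f i) i x :=
    continuous_finsetSum _ fun i _ => continuous_pd (hf i) i
  obtain ⟨M, hM, hMb⟩ := exists_bound_of_continuous hΩ
    (q := fun x => divMul f B x - 2 * B x * ∑ i, pd (f i) i x)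
    ((contDiff_divMul (m := 0) hf hBc (by norm_num)).continuous.sub
      ((continuous_const.mul hBc.continuous).mul hDc))
  refine ⟨2 * M / b, by positivity, fun s hs K v hK hKΩ hv h0 => ?_⟩
  have hspos : 0 < s := lt_of_lt_of_le (by positivity) hs
  set ρ : EuclideanSpace ℝ (Fin n) → ℝ := fun x => Real.exp (2 * s * φ x) with hρdef
  have hρ : ContDiff ℝ 1 ρ := (contDiff_const.mul hφ1).exp
  have hF : ContDiff ℝ 1 fun x => ρ x * (v x * v x) * B x := (hρ.mul (hv.mul hv)).mul hBc
  have hF0 : ∀ x ∉ K, ρ x * (v x * v x) * B x = 0 := fun x hx => by simp [h0 x hx]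
  have hdF : ∫ x, divMul f (fun x => ρ x * (v x * v x) * B x) x = 0 := by
    have hz : ∀ i, ∀ x ∉ K, ρ x * (v x * v x) * B x * f i x = 0 := fun i x hx => by
      simp [h0 x hx]
    simp only [divMul]
    rw [integral_finsetSum]
    · exact Finset.sum_eq_zero fun i _ => integral_pd_eq_zero hK (hF.mul (hf i)) (hz i) i
    · exact fun i _ => integrable_of_eq_zero_off_compact hK (continuous_pd (hF.mul (hf i)) i)
        (pd_eq_zero_of_notMem hK.isClosed (hz i) i)
  have hIF := integrable_of_eq_zero_off_compact hK
    (contDiff_divMul (m := 0) hf hF (by norm_num)).continuous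
    (divMul_eq_zero_of_notMem f hK.isClosed hF0)
  have hIv := integrable_of_eq_zero_off_compact (f := fun x => v x ^ 2 * ρ x) hK
    ((hv.continuous.pow 2).mul hρ.continuous) (fun x hx => by simp [h0 x hx])
  have hIL := integrable_of_eq_zero_off_compact (f := fun x => divMul f v x ^ 2 * ρ x) hK
    (((contDiff_divMul (m := 0) hf hv (by norm_num)).continuous.pow 2).mul hρ.continuous)
    (fun x hx => by simp [divMul_eq_zero_of_notMem f hK.isClosed h0 x hx])
  have hpt : ∫ x, (b / 2 * s ^ 2) * (v x ^ 2 * ρ x) ≤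
      ∫ x, (divMul f v x ^ 2 * ρ x + s * divMul f (fun x => ρ x * (v x * v x) * B x) x) := by
    refine integral_mono (hIv.const_mul _) (hIL.add (hIF.const_mul s)) fun x => ?_
    by_cases hx : x ∈ K
    · have hdv := hv.differentiable (by norm_num)
      have hdρ := hρ.differentiable (by norm_num)
      have hdB := hBc.differentiable (by norm_num)
      have hdf : ∀ i, Differentiable ℝ (f i) := fun i => (hf i).differentiable (by norm_num)
      have hρpos : 0 < ρ x := Real.exp_pos _
      have hq := (abs_le.1 (hMb x (hKΩ hx))).1
      have hBx : b ≤ B x ^ 2 := hB x (hKΩ hx)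
      have hexp : divMul f (fun x => ρ x * (v x * v x) * B x) x =
          ρ x * (2 * s * v x ^ 2 * B x ^ 2 + 2 * v x * B x * ∑ i, pd v i x * f i x
            + v x ^ 2 * divMul f B x) := by
        rw [divMul_eq hdf (hF.differentiable (by norm_num)), divMul_eq hdf hdB]
        have h1 : ∀ i, pd (fun x => ρ x * (v x * v x) * B x) i x * f i x =
            2 * s * ρ x * v x ^ 2 * B x * (f i x * pd φ i x)
              + 2 * ρ x * v x * B x * (pd v i x * f i x)
              + ρ x * v x ^ 2 * (pd B i x * f i x) := by
          intro i
          rw [pd_mul (hdρ.fun_mul (hdv.fun_mul hdv)) hdB, pd_mul hdρ (hdv.fun_mul hdv), pd_mul hdv hdv,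
            pd_exp_const_mul (hφ1.differentiable (by norm_num))]
          simp only [hρdef]
          ring
        simp only [h1, Finset.sum_add_distrib, ← Finset.mul_sum]
        have h2 : ∑ i, f i x * pd φ i x = B x := rfl
        rw [h2]
        ring
      have hT : ∑ i, pd v i x * f i x = divMul f v x - v x * ∑ i, pd (f i) i x := by
        rw [divMul_eq hdf hdv]; ring
      simp only
      rw [hexp, hT]
      have hsM : M ≤ b / 2 * s := by
        have := (div_le_iff₀ hb).1 hs
        linarith
      have hkey : b / 2 * s ^ 2 * v x ^ 2 ≤ divMul f v x ^ 2 + s * (2 * s * v x ^ 2 * B x ^ 2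
          + 2 * v x * B x * (divMul f v x - v x * ∑ i, pd (f i) i x)
          + v x ^ 2 * divMul f B x) := by
        have e1 : 0 ≤ (s ^ 2 * v x ^ 2) * (B x ^ 2 - b) :=
          mul_nonneg (by positivity) (by linarith)
        have e2 : 0 ≤ (s * v x ^ 2) *
            (divMul f B x - 2 * B x * ∑ i, pd (f i) i x + M) :=
          mul_nonneg (by positivity) (by linarith)
        have e3 : 0 ≤ (s * v x ^ 2) * (b / 2 * s - M) :=
          mul_nonneg (by positivity) (by linarith)
        nlinarith [sq_nonneg (divMul f v x + s * v x * B x)]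
      nlinarith [mul_le_mul_of_nonneg_left hkey hρpos.le]
    · simp [h0 x hx, divMul_eq_zero_of_notMem f hK.isClosed h0 x hx,
        divMul_eq_zero_of_notMem f hK.isClosed hF0 x hx]
  rw [integral_add hIL (hIF.const_mul s), integral_const_mul, integral_const_mul, hdF, mul_zero,
    add_zero] at hpt
  rw [div_mul_eq_mul_div, le_div_iff₀ hb]
  linarith

theorem pd_divMul {n : ℕ} {f : Fin n → EuclideanSpace ℝ (Fin n) → ℝ}
    {g : EuclideanSpace ℝ (Fin n) → ℝ} (hf : ∀ i, ContDiff ℝ 2 (f i)) (hg : ContDiff ℝ 2 g)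
    (k : Fin n) (x : EuclideanSpace ℝ (Fin n)) :
    pd (divMul f g) k x = divMul f (pd g k) x + ∑ i, pd g i x * pd (f i) k x
      + g x * pd (fun y => ∑ i, pd (f i) i y) k x := by
  have hdf : ∀ i, Differentiable ℝ (f i) := fun i => (hf i).differentiable (by norm_num)
  have hdg : Differentiable ℝ g := hg.differentiable (by norm_num)
  have hpd : ∀ {u : EuclideanSpace ℝ (Fin n) → ℝ}, ContDiff ℝ 2 u → ∀ i,
      Differentiable ℝ (pd u i) := fun hu i =>
    (contDiff_pd (m := 1) hu (by norm_num) i).differentiable (by norm_num)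
  have hD : Differentiable ℝ fun y => ∑ i, pd (f i) i y :=
    Differentiable.fun_sum fun i _ => hpd (hf i) i
  have h1 : divMul f g =
      fun y => ∑ i, pd g i y * f i y + g y * ∑ i, pd (f i) i y :=
    funext fun y => divMul_eq hdf hdg y
  rw [h1, pd_add (Differentiable.fun_sum fun i _ => (hpd hg i).fun_mul (hdf i))
    (hdg.fun_mul hD), pd_sum _ fun i => (hpd hg i).fun_mul (hdf i), pd_mul hdg hD,
    divMul_eq hdf (hpd hg k)]
  simp only [pd_mul (hpd hg _) (hdf _), Finset.sum_add_distrib, pd_comm hg _ k]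
  ring

theorem exp_two_mul_mul (s t : ℝ) : Real.exp (2 * s * t) = Real.exp (s * t) ^ 2 := by
  rw [← Real.exp_nat_mul]
  congr 1
  push_cast
  ring

/-- Commuting `v ↦ div(v f)` with a partial derivative, in weighted form. -/
theorem exists_weighted_commutator_bound {n : ℕ} {Ω : Set (EuclideanSpace ℝ (Fin n))}
    (hΩ : Bornology.IsBounded Ω) {f : Fin n → EuclideanSpace ℝ (Fin n) → ℝ}
    (hf : ∀ i, ContDiff ℝ 2 (f i)) {φ : EuclideanSpace ℝ (Fin n) → ℝ} (hφ : ContDiff ℝ 2 φ) :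
    ∃ A > (0 : ℝ), ∀ (s : ℝ) (g : EuclideanSpace ℝ (Fin n) → ℝ), ContDiff ℝ 2 g →
      ∀ x ∈ Ω, ∀ k : Fin n, divMul f (pd g k) x ^ 2 * Real.exp (2 * s * φ x) ≤
        A * (pd (fun y => Real.exp (s * φ y) * divMul f g y) k x ^ 2
          + s ^ 2 * (Real.exp (s * φ x) * divMul f g x) ^ 2
          + (g x ^ 2 + ∑ i, pd g i x ^ 2) * Real.exp (2 * s * φ x)) := by
  have hφ1 : ContDiff ℝ 1 φ := hφ.of_le (by norm_num)
  have hDc : ContDiff ℝ 1 fun y => ∑ i, pd (f i) i y :=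
    ContDiff.sum fun i _ => contDiff_pd (hf i) (by norm_num) i
  obtain ⟨M, hM, hMb⟩ := exists_bound_of_continuous hΩ
    (q := fun x => ∑ k, (∑ i, pd (f i) k x ^ 2 + pd (fun y => ∑ i, pd (f i) i y) k x ^ 2
      + pd φ k x ^ 2))
    (continuous_finsetSum _ fun k _ =>
      ((continuous_finsetSum _ fun i _ =>
        (continuous_pd ((hf i).of_le (by norm_num)) k).pow 2).add
        ((continuous_pd hDc k).pow 2)).add ((continuous_pd hφ1 k).pow 2))
  refine ⟨3 + 6 * M, by positivity, fun s g hg x hx k => ?_⟩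
  have hk : ∑ i, pd (f i) k x ^ 2 + pd (fun y => ∑ i, pd (f i) i y) k x ^ 2 + pd φ k x ^ 2
      ≤ M :=
    (Finset.single_le_sum (f := fun k => ∑ i, pd (f i) k x ^ 2
      + pd (fun y => ∑ i, pd (f i) i y) k x ^ 2 + pd φ k x ^ 2)
      (fun k _ => by positivity) (Finset.mem_univ k)).trans (abs_le.1 (hMb x hx)).2
  have hLd : Differentiable ℝ (divMul f g) :=
    (contDiff_divMul (m := 1) hf hg (by norm_num)).differentiable (by norm_num)
  have hE : Differentiable ℝ fun y => Real.exp (s * φ y) :=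
    (contDiff_const.mul hφ1).exp.differentiable (by norm_num)
  rw [pd_mul hE hLd, pd_exp_const_mul (hφ1.differentiable (by norm_num)), pd_divMul hf hg,
    exp_two_mul_mul]
  have hCS := Finset.sum_mul_sq_le_sq_mul_sq Finset.univ (fun i => pd g i x)
    (fun i => pd (f i) k x)
  have hF0 : 0 ≤ ∑ i, pd (f i) k x ^ 2 := by positivity
  have hG0 : 0 ≤ ∑ i, pd g i x ^ 2 := by positivity
  generalize pd (fun y => ∑ i, pd (f i) i y) k x = D at *
  generalize ∑ i, pd (f i) k x ^ 2 = F at *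
  generalize ∑ i, pd g i x ^ 2 = G at *
  generalize ∑ i, pd g i x * pd (f i) k x = S at *
  generalize divMul f (pd g k) x = T
  generalize divMul f g x = L
  generalize Real.exp (s * φ x) = e
  generalize pd φ k x = p at *
  generalize g x = γ
  have hS : S ^ 2 ≤ M * G := by
    nlinarith [mul_le_mul_of_nonneg_right (show F ≤ M by nlinarith [sq_nonneg D, sq_nonneg p]) hG0]
  have hD : γ ^ 2 * D ^ 2 ≤ M * γ ^ 2 := by
    nlinarith [mul_le_mul_of_nonneg_right (show D ^ 2 ≤ M by nlinarith [sq_nonneg p])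
      (sq_nonneg γ)]
  have hp : s ^ 2 * (e * L) ^ 2 * p ^ 2 ≤ M * (s ^ 2 * (e * L) ^ 2) := by
    nlinarith [mul_le_mul_of_nonneg_right (show p ^ 2 ≤ M by nlinarith [sq_nonneg D])
      (show 0 ≤ s ^ 2 * (e * L) ^ 2 by positivity)]
  have hSD : (S + γ * D) ^ 2 ≤ 2 * M * (γ ^ 2 + G) := by
    nlinarith [sq_nonneg (S - γ * D)]
  have three : ∀ a b c : ℝ, (a - b - c) ^ 2 ≤ 3 * (a ^ 2 + b ^ 2 + c ^ 2) := fun a b c => by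
    nlinarith [sq_nonneg (a + b), sq_nonneg (a + c), sq_nonneg (b - c)]
  set H := e * (s * p) * L + e * (T + S + γ * D) with hH
  have h3 := three H (s * p * (e * L)) (e * (S + γ * D))
  have hT : H - s * p * (e * L) - e * (S + γ * D) = e * T := by rw [hH]; ring
  rw [hT] at h3
  have hb : (s * p * (e * L)) ^ 2 ≤ M * (s ^ 2 * (e * L) ^ 2) := by
    calc (s * p * (e * L)) ^ 2 = s ^ 2 * (e * L) ^ 2 * p ^ 2 := by ring
      _ ≤ _ := hp
  have hc : (e * (S + γ * D)) ^ 2 ≤ 2 * M * ((γ ^ 2 + G) * e ^ 2) := by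
    calc (e * (S + γ * D)) ^ 2 = (S + γ * D) ^ 2 * e ^ 2 := by ring
      _ ≤ 2 * M * (γ ^ 2 + G) * e ^ 2 := mul_le_mul_of_nonneg_right hSD (sq_nonneg e)
      _ = _ := by ring
  have n1 : 0 ≤ M * H ^ 2 := by positivity
  have n2 : 0 ≤ s ^ 2 * (e * L) ^ 2 := by positivity
  have n3 : 0 ≤ (γ ^ 2 + G) * e ^ 2 := by positivity
  have n4 : 0 ≤ M * (s ^ 2 * (e * L) ^ 2) := by positivity
  calc T ^ 2 * e ^ 2 = (e * T) ^ 2 := by ring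
    _ ≤ _ := h3
    _ ≤ 3 * (H ^ 2 + M * (s ^ 2 * (e * L) ^ 2) + 2 * M * ((γ ^ 2 + G) * e ^ 2)) := by linarith
    _ ≤ _ := by linarith

/-- Carleman estimate for `g` and its gradient in terms of the gradient of `e^{sφ} div(g f)`. -/
theorem carleman_divMul_gradient {n : ℕ} [Nonempty (Fin n)]
    {Ω : Set (EuclideanSpace ℝ (Fin n))}
    (hΩ : Bornology.IsBounded Ω) {f : Fin n → EuclideanSpace ℝ (Fin n) → ℝ}
    (hf : ∀ i, ContDiff ℝ 2 (f i)) {φ : EuclideanSpace ℝ (Fin n) → ℝ} (hφ : ContDiff ℝ 2 φ)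
    {b : ℝ} (hb : 0 < b) (hB : ∀ x ∈ Ω, b ≤ (∑ i, f i x * pd φ i x) ^ 2) :
    ∃ C > (0 : ℝ), ∃ s2 > (0 : ℝ), ∀ s ≥ s2, ∀ (K : Set (EuclideanSpace ℝ (Fin n)))
      (g : EuclideanSpace ℝ (Fin n) → ℝ), IsCompact K → K ⊆ Ω → ContDiff ℝ 2 g →
      (∀ x ∉ K, g x = 0) →
      ∫ x, (g x ^ 2 + ∑ i, pd g i x ^ 2) * Real.exp (2 * s * φ x) ≤
        C * ∫ x, ∑ i, pd (fun y => Real.exp (s * φ y) * divMul f g y) i x ^ 2 := by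
  obtain ⟨i₀⟩ := ‹Nonempty (Fin n)›
  obtain ⟨s1, hs1, hcar⟩ := carleman_divMul hΩ (fun i => (hf i).of_le (by norm_num)) hφ hb hB
  obtain ⟨A, hA, hcomm⟩ := exists_weighted_commutator_bound hΩ hf hφ
  obtain ⟨P, hP, hpoin⟩ := poincare_of_bounded hΩ i₀
  set c := 2 / b with hc
  have hcpos : 0 < c := by positivity
  refine ⟨2 * (c * P + c * A + c * A * n * P), by positivity,
    s1 + (1 + 2 * (c * A * n)), by positivity, fun s hs K g hK hKΩ hg h0 => ?_⟩
  have hcAn : 0 ≤ c * A * n := by positivity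
  have hs1' : s1 ≤ s := by linarith
  have hsone : 1 ≤ s := by linarith
  have hsbig : 2 * (c * A * n) ≤ s ^ 2 := by nlinarith
  have hφ1 : ContDiff ℝ 1 φ := hφ.of_le (by norm_num)
  have hg1 : ContDiff ℝ 1 g := hg.of_le (by norm_num)
  have hL : ContDiff ℝ 1 (divMul f g) := contDiff_divMul hf hg (by norm_num)
  have hE : ContDiff ℝ 1 fun y => Real.exp (s * φ y) := (contDiff_const.mul hφ1).exp
  have hρ : Continuous fun y => Real.exp (2 * s * φ y) :=
    (continuous_const.mul hφ.continuous).rexp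
  set h : EuclideanSpace ℝ (Fin n) → ℝ := fun y => Real.exp (s * φ y) * divMul f g y with hh
  have hhc : ContDiff ℝ 1 h := hE.mul hL
  have hL0 := divMul_eq_zero_of_notMem f hK.isClosed h0
  have hh0 : ∀ x ∉ K, h x = 0 := fun x hx => by simp [hh, hL0 x hx]
  have hg0 := pd_eq_zero_of_notMem hK.isClosed h0
  have hhd0 := pd_eq_zero_of_notMem hK.isClosed hh0
  have hgk : ∀ k, ContDiff ℝ 1 (pd g k) := fun k => contDiff_pd hg (by norm_num) k
  have hIg := integrable_of_eq_zero_off_compact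
    (f := fun x => g x ^ 2 * Real.exp (2 * s * φ x)) hK
    ((hg.continuous.pow 2).mul hρ) (fun x hx => by simp [h0 x hx])
  have hIgk : ∀ k, Integrable fun x => pd g k x ^ 2 * Real.exp (2 * s * φ x) := fun k =>
    integrable_of_eq_zero_off_compact hK (((hgk k).continuous.pow 2).mul hρ)
      (fun x hx => by simp [hg0 k x hx])
  have hIJ : Integrable fun x => (g x ^ 2 + ∑ i, pd g i x ^ 2) * Real.exp (2 * s * φ x) :=
    integrable_of_eq_zero_off_compact hK
      (((hg.continuous.pow 2).add (continuous_finsetSum _ fun k _ =>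
        (hgk k).continuous.pow 2)).mul hρ) (fun x hx => by simp [h0 x hx, hg0 _ x hx])
  have hIh : Integrable fun x => h x ^ 2 :=
    integrable_of_eq_zero_off_compact hK (hhc.continuous.pow 2) (fun x hx => by simp [hh0 x hx])
  have hIhk : ∀ k, Integrable fun x => pd h k x ^ 2 := fun k =>
    integrable_of_eq_zero_off_compact hK ((continuous_pd hhc k).pow 2)
      (fun x hx => by simp [hhd0 k x hx])
  have hILk : ∀ k, Integrable fun x => divMul f (pd g k) x ^ 2 * Real.exp (2 * s * φ x) :=
    fun k => integrable_of_eq_zero_off_compact hK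
      (((contDiff_divMul (m := 0) (fun i => (hf i).of_le (by norm_num)) (hgk k)
        (by norm_num)).continuous.pow 2).mul hρ)
      (fun x hx => by simp [divMul_eq_zero_of_notMem f hK.isClosed (hg0 k) x hx])
  have hJ : ∫ x, (g x ^ 2 + ∑ i, pd g i x ^ 2) * Real.exp (2 * s * φ x) =
      (∫ x, g x ^ 2 * Real.exp (2 * s * φ x))
        + ∑ k, ∫ x, pd g k x ^ 2 * Real.exp (2 * s * φ x) := by
    rw [← integral_finsetSum _ fun k _ => hIgk k,
      ← integral_add hIg (integrable_finsetSum _ fun k _ => hIgk k)]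
    simp only [add_mul, Finset.sum_mul]
  have hH1 : ∫ x, ∑ i, pd h i x ^ 2 = ∑ k, ∫ x, pd h k x ^ 2 :=
    integral_finsetSum _ fun k _ => hIhk k
  have hgest : s ^ 2 * ∫ x, g x ^ 2 * Real.exp (2 * s * φ x) ≤ c * ∫ x, h x ^ 2 := by
    have := hcar s hs1' K g hK hKΩ hg1 h0
    refine this.trans_eq ?_
    congr 2
    funext x
    rw [exp_two_mul_mul, hh]
    ring
  have hkest : ∀ k, s ^ 2 * ∫ x, pd g k x ^ 2 * Real.exp (2 * s * φ x) ≤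
      c * (A * ((∫ x, pd h k x ^ 2) + s ^ 2 * (∫ x, h x ^ 2)
        + ∫ x, (g x ^ 2 + ∑ i, pd g i x ^ 2) * Real.exp (2 * s * φ x))) := by
    intro k
    refine (hcar s hs1' K (pd g k) hK hKΩ (hgk k) (hg0 k)).trans
      (mul_le_mul_of_nonneg_left ?_ hcpos.le)
    have hI : Integrable fun x => pd h k x ^ 2 + s ^ 2 * h x ^ 2 :=
      (hIhk k).add (hIh.const_mul _)
    rw [← integral_const_mul (s ^ 2), ← integral_add (hIhk k) (hIh.const_mul _),
      ← integral_add hI hIJ, ← integral_const_mul]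
    refine integral_mono (hILk k) ((hI.add hIJ).const_mul _) fun x => ?_
    by_cases hx : x ∈ K
    · exact hcomm s g hg x (hKΩ hx) k
    · simp [divMul_eq_zero_of_notMem f hK.isClosed (hg0 k) x hx, h0 x hx, hg0 _ x hx,
        hh0 x hx, hhd0 k x hx]
  have hsum := Finset.sum_le_sum fun k (_ : k ∈ Finset.univ) => hkest k
  simp only [← Finset.mul_sum, Finset.sum_add_distrib, Finset.sum_const, Finset.card_univ,
    Fintype.card_fin, nsmul_eq_mul] at hsum
  have hH0 : ∫ x, h x ^ 2 ≤ P * ∑ k, ∫ x, pd h k x ^ 2 :=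
    (hpoin K h hK hKΩ hhc hh0).trans (mul_le_mul_of_nonneg_left
      (Finset.single_le_sum (f := fun k => ∫ x, pd h k x ^ 2)
        (fun k _ => integral_nonneg fun x => sq_nonneg _) (Finset.mem_univ i₀)) hP.le)
  have hJ0 : 0 ≤ ∫ x, (g x ^ 2 + ∑ i, pd g i x ^ 2) * Real.exp (2 * s * φ x) :=
    integral_nonneg fun x => by positivity
  have hH10 : 0 ≤ ∑ k, ∫ x, pd h k x ^ 2 :=
    Finset.sum_nonneg fun k _ => integral_nonneg fun x => sq_nonneg _
  rw [hH1]
  generalize (∫ x, (g x ^ 2 + ∑ i, pd g i x ^ 2) * Real.exp (2 * s * φ x)) = J at *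
  generalize (∑ k, ∫ x, pd h k x ^ 2) = H1 at *
  generalize (∫ x, h x ^ 2) = H0 at *
  have hs2 : 1 ≤ s ^ 2 := one_le_pow₀ hsone
  have htot : s ^ 2 * J ≤ c * H0 + c * (A * (H1 + n * (s ^ 2 * H0) + n * J)) := by
    have hsJ := congrArg (s ^ 2 * ·) hJ
    simp only [mul_add] at hsJ
    linarith
  have e1 : c * H0 ≤ s ^ 2 * (c * P * H1) := by
    calc c * H0 ≤ c * (P * H1) := by gcongr
      _ = 1 * (c * P * H1) := by ring
      _ ≤ _ := by gcongr
  have e2 : c * A * H1 ≤ s ^ 2 * (c * A * H1) := by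
    calc c * A * H1 = 1 * (c * A * H1) := by ring
      _ ≤ _ := by gcongr
  have e3 : c * A * n * s ^ 2 * H0 ≤ s ^ 2 * (c * A * n * P * H1) := by
    calc c * A * n * s ^ 2 * H0 ≤ c * A * n * s ^ 2 * (P * H1) := by gcongr
      _ = _ := by ring
  have e4 : 2 * (c * A * n) * J ≤ s ^ 2 * J := by gcongr
  have hspos : 0 < s ^ 2 := by positivity
  refine le_of_mul_le_mul_left ?_ hspos
  linarith

/-- Lemma 3.2 of the paper: under the hypotheses of the first-order estimate,
`∫_Ω (g² + |∇g|²) e^{2sφ₀} ≤ C ∫_Ω |∇(e^{sφ₀} L₀ g)|²` for all `s ≥ s₂`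
and `g ∈ H₀²(Ω)`. -/
theorem carleman_L0_gradient_form {n : ℕ}
    (Ω : Set (EuclideanSpace ℝ (Fin n))) (hΩo : IsOpen Ω)
    (hΩb : Bornology.IsBounded Ω)
    (a : EuclideanSpace ℝ (Fin n) → Fin n → Fin n → ℝ)
    (ha : ∀ i j, ContDiff ℝ 2 (fun x => a x i j))
    (hasymm : ∀ x i j, a x i j = a x j i)
    (u0 : EuclideanSpace ℝ (Fin n) → ℝ) (hu0 : ContDiff ℝ 3 u0)
    (d : EuclideanSpace ℝ (Fin n) → ℝ) (hd : ContDiff ℝ 2 d)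
    (hdpos : ∀ x ∈ closure Ω, 0 < d x)
    (lam : ℝ) (hlam : 0 < lam) (κ2 : ℝ) (hκ2 : 0 < κ2)
    (hnondeg : ∀ᵐ x ∂(volume.restrict Ω),
      κ2 ≤ |∑ i, (∑ j, a x i j * pd u0 j x) * pd d i x|) :
    ∃ C > (0 : ℝ), ∃ s2 > (0 : ℝ), ∀ s ≥ s2,
      ∀ g : EuclideanSpace ℝ (Fin n) → ℝ,
        ContDiff ℝ 2 g → HasCompactSupport g → tsupport g ⊆ Ω →
        (∫ x in Ω, (g x ^ 2 + ∑ i, pd g i x ^ 2)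
            * Real.exp (2 * s * Real.exp (lam * d x))) ≤
          C * ∫ x in Ω,
            ∑ i, pd (fun y => Real.exp (s * Real.exp (lam * d y)) * L0op a u0 g y) i x ^ 2 := by
  set f : Fin n → EuclideanSpace ℝ (Fin n) → ℝ := fun i y => ∑ j, a y i j * pd u0 j y with hfdef
  have hf : ∀ i, ContDiff ℝ 2 (f i) := fun i =>
    ContDiff.sum fun j _ => (ha i j).mul (contDiff_pd hu0 (by norm_num) j)
  have hd1 : ContDiff ℝ 1 d := hd.of_le (by norm_num)
  have hcont : Continuous fun x => |∑ i, f i x * pd d i x| :=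
    (continuous_finsetSum _ fun i _ => (hf i).continuous.mul (continuous_pd hd1 i)).abs
  have hκ : ∀ x ∈ Ω, κ2 ≤ |∑ i, f i x * pd d i x| := by
    have hU : IsOpen (Ω ∩ {x | |∑ i, f i x * pd d i x| < κ2}) :=
      hΩo.inter (isOpen_lt hcont continuous_const)
    have hU0 : volume (Ω ∩ {x | |∑ i, f i x * pd d i x| < κ2}) = 0 := by
      rw [ae_restrict_iff' hΩo.measurableSet, ae_iff] at hnondeg
      simpa only [Classical.not_imp, not_le] using! hnondeg
    rw [hU.measure_eq_zero_iff (μ := volume)] at hU0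
    intro x hx
    by_contra! hlt
    exact (Set.eq_empty_iff_forall_notMem.1 hU0 x) ⟨hx, hlt⟩
  rcases Ω.eq_empty_or_nonempty with rfl | ⟨x₀, hx₀⟩
  · exact ⟨1, one_pos, 1, one_pos, fun s _ g _ _ _ => by simp⟩
  have hne : Nonempty (Fin n) := by
    by_contra hemp
    rw [not_nonempty_iff] at hemp
    have := hκ x₀ hx₀
    simp only [Finset.univ_eq_empty, Finset.sum_empty, abs_zero] at this
    linarith
  have hφ : ContDiff ℝ 2 fun x => Real.exp (lam * d x) := (contDiff_const.mul hd).exp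
  have hB : ∀ x ∈ Ω,
      (lam * κ2) ^ 2 ≤ (∑ i, f i x * pd (fun x => Real.exp (lam * d x)) i x) ^ 2 := by
    intro x hx
    have hone : 1 ≤ Real.exp (lam * d x) :=
      Real.one_le_exp (mul_nonneg hlam.le (hdpos x (subset_closure hx)).le)
    have hfac : ∑ i, f i x * pd (fun x => Real.exp (lam * d x)) i x =
        Real.exp (lam * d x) * lam * ∑ i, f i x * pd d i x := by
      rw [Finset.mul_sum]
      refine Finset.sum_congr rfl fun i _ => ?_
      rw [pd_exp_const_mul (hd1.differentiable (by norm_num))]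
      ring
    rw [hfac, ← sq_abs (_ * _ * _), abs_mul, abs_of_pos (by positivity)]
    refine pow_le_pow_left₀ (by positivity) ?_ 2
    calc lam * κ2 = 1 * lam * κ2 := by ring
      _ ≤ _ := mul_le_mul (by gcongr) (hκ x hx) hκ2.le (by positivity)
  obtain ⟨C, hC, s2, hs2, hmain⟩ :=
    carleman_divMul_gradient hΩb hf hφ (b := (lam * κ2) ^ 2) (by positivity) hB
  refine ⟨C, hC, s2, hs2, fun s hs g hg hgc hgΩ => ?_⟩
  have h0 : ∀ x ∉ tsupport g, g x = 0 := fun x hx => image_eq_zero_of_notMem_tsupport hx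
  have hL0 : ∀ x ∉ tsupport g,
      Real.exp (s * Real.exp (lam * d x)) * L0op a u0 g x = 0 := fun x hx => by
    rw [show L0op a u0 g x = 0 from
      divMul_eq_zero_of_notMem f (isClosed_tsupport g) h0 x hx, mul_zero]
  rw [setIntegral_eq_integral_of_forall_compl_eq_zero fun x hx => ?_,
    setIntegral_eq_integral_of_forall_compl_eq_zero fun x hx => ?_]
  · exact hmain s hs (tsupport g) g hgc hgΩ hg h0
  · exact Finset.sum_eq_zero fun i _ => by
      rw [pd_eq_zero_of_notMem (isClosed_tsupport g) hL0 i x fun hm => hx (hgΩ hm)]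
      norm_num
  · have hx' : x ∉ tsupport g := fun hm => hx (hgΩ hm)
    simp [h0 x hx', pd_eq_zero_of_notMem (isClosed_tsupport g) h0 _ x hx']
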